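/- arXiv:1202.4862 — 3 statements merged into one kernel-verified Lean document; each statement's English description precedes it below -/
import Mathlib

section
/- The base graph w₁₃ has chromatic number equal to 4. -/
/-- The base graph `w₁₃`: the simple graph on `Fin 7` with the twelve edges
`{0,1},{0,2},{1,2},{1,3},{2,3},{0,4},{2,4},{0,5},{1,5},{3,6},{4,6},{5,6}`. -/
def w13 : SimpleGraph (Fin 7) :=
  SimpleGraph.fromEdgeSet
    {s(0, 1), s(0, 2), s(1, 2), s(1, 3), s(2, 3), s(0, 4),
     s(2, 4), s(0, 5), s(1, 5), s(3, 6), s(4, 6), s(5, 6)}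

/-- The base graph `w₁₃` has chromatic number equal to 4. -/
theorem w13_chromaticNumber : w13.chromaticNumber = 4 := by
  refine (SimpleGraph.chromaticNumber_eq_iff_colorable_not_colorable (n := 3)).2 ⟨?_, ?_⟩
  · refine ⟨SimpleGraph.Coloring.mk (![0, 1, 2, 0, 1, 2, 3] : Fin 7 → Fin 4) ?_⟩
    intro v w h
    rw [w13, SimpleGraph.fromEdgeSet_adj] at h
    revert v w
    simp only [Set.mem_insert_iff, Set.mem_singleton_iff]
    decide
  · rintro ⟨c⟩
    have h01 : c 0 ≠ c 1 := c.valid (by simp [w13])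
    have h02 : c 0 ≠ c 2 := c.valid (by simp [w13])
    have h12 : c 1 ≠ c 2 := c.valid (by simp [w13])
    have h13 : c 1 ≠ c 3 := c.valid (by simp [w13])
    have h23 : c 2 ≠ c 3 := c.valid (by simp [w13])
    have h04 : c 0 ≠ c 4 := c.valid (by simp [w13])
    have h24 : c 2 ≠ c 4 := c.valid (by simp [w13])
    have h05 : c 0 ≠ c 5 := c.valid (by simp [w13])
    have h15 : c 1 ≠ c 5 := c.valid (by simp [w13])
    have h36 : c 3 ≠ c 6 := c.valid (by simp [w13])
    have h46 : c 4 ≠ c 6 := c.valid (by simp [w13])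
    have h56 : c 5 ≠ c 6 := c.valid (by simp [w13])
    -- The triangle `0, 1, 2` uses all three colors, which forces the colors of `3`, `4`, `5`.
    have h03 : c 3 = c 0 := by lia
    have h14 : c 4 = c 1 := by lia
    have h25 : c 5 = c 2 := by lia
    lia
end

section
/- The base graph w₁₃ is 4-critical: its chromatic number equals 4 and for every edge e of w₁₃, the graph obtained from w₁₃ by deleting e is 3-colorable. -/
theorem w13_adj {a b : Fin 7} :
    w13.Adj a b ↔
      s(a, b) ∈ ({s(0, 1), s(0, 2), s(1, 2), s(1, 3), s(2, 3), s(0, 4),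
        s(2, 4), s(0, 5), s(1, 5), s(3, 6), s(4, 6), s(5, 6)} : Finset (Sym2 (Fin 7))) := by
  revert a b
  simp only [w13, SimpleGraph.fromEdgeSet_adj, Set.mem_insert_iff, Set.mem_singleton_iff]
  decide

instance : DecidableRel w13.Adj := fun _ _ => decidable_of_iff _ w13_adj.symm

theorem w13_not_colorable_three : ¬ w13.Colorable 3 := by
  rintro ⟨c⟩
  have h01 := c.valid (show w13.Adj 0 1 by decide)
  have h02 := c.valid (show w13.Adj 0 2 by decide)
  have h12 := c.valid (show w13.Adj 1 2 by decide)
  have h13 := c.valid (show w13.Adj 1 3 by decide)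
  have h23 := c.valid (show w13.Adj 2 3 by decide)
  have h04 := c.valid (show w13.Adj 0 4 by decide)
  have h24 := c.valid (show w13.Adj 2 4 by decide)
  have h05 := c.valid (show w13.Adj 0 5 by decide)
  have h15 := c.valid (show w13.Adj 1 5 by decide)
  have h36 := c.valid (show w13.Adj 3 6 by decide)
  have h46 := c.valid (show w13.Adj 4 6 by decide)
  have h56 := c.valid (show w13.Adj 5 6 by decide)
  grind

theorem w13_deleteEdges_colorable {e : Sym2 (Fin 7)} (c : Fin 7 → Fin 3)
    (hc : ∀ a b, w13.Adj a b → s(a, b) ≠ e → c a ≠ c b) :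
    (w13.deleteEdges {e}).Colorable 3 :=
  ⟨SimpleGraph.Coloring.mk c fun {a b} h => by
    rw [SimpleGraph.deleteEdges_adj, Set.mem_singleton_iff] at h
    exact hc a b h.1 h.2⟩

theorem w13_colorable_four : w13.Colorable 4 :=
  ⟨SimpleGraph.Coloring.mk ![0, 1, 2, 0, 1, 2, 3] fun {a b} => by
    revert a b
    decide⟩

/-- The base graph `w₁₃` is 4-critical: its chromatic number equals 4 and deleting
any edge yields a 3-colorable graph. -/
theorem w13_fourCritical :
    w13.chromaticNumber = 4 ∧
      ∀ e ∈ w13.edgeSet, (w13.deleteEdges {e}).Colorable 3 := by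
  refine ⟨SimpleGraph.chromaticNumber_eq_iff_colorable_not_colorable.mpr
    ⟨w13_colorable_four, w13_not_colorable_three⟩, fun e he => ?_⟩
  induction e with | _ a b
  rw [SimpleGraph.mem_edgeSet, w13_adj] at he
  simp only [Finset.mem_insert, Finset.mem_singleton] at he
  rcases he with h | h | h | h | h | h | h | h | h | h | h | h <;> rw [h]
  · exact w13_deleteEdges_colorable ![0, 0, 1, 2, 2, 1, 0] (by decide)
  · exact w13_deleteEdges_colorable ![0, 1, 0, 2, 1, 2, 0] (by decide)
  · exact w13_deleteEdges_colorable ![0, 1, 1, 0, 2, 2, 1] (by decide)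
  · exact w13_deleteEdges_colorable ![0, 1, 2, 1, 1, 2, 0] (by decide)
  · exact w13_deleteEdges_colorable ![0, 1, 2, 2, 1, 2, 0] (by decide)
  · exact w13_deleteEdges_colorable ![0, 1, 2, 0, 0, 2, 1] (by decide)
  · exact w13_deleteEdges_colorable ![0, 1, 2, 0, 2, 2, 1] (by decide)
  · exact w13_deleteEdges_colorable ![0, 1, 2, 0, 1, 0, 2] (by decide)
  · exact w13_deleteEdges_colorable ![0, 1, 2, 0, 1, 1, 2] (by decide)
  · exact w13_deleteEdges_colorable ![0, 1, 2, 0, 1, 2, 0] (by decide)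
  · exact w13_deleteEdges_colorable ![0, 1, 2, 0, 1, 2, 1] (by decide)
  · exact w13_deleteEdges_colorable ![0, 1, 2, 0, 1, 2, 2] (by decide)
end

section
/- For every vertex v of the base graph w₁₃ there exists a proper coloring of w₁₃ with 4 colors in which v is the unique vertex receiving its color (a 'lonely color'). -/
/-- Row `v` is a proper 4-coloring of `w13` in which only `v` receives the color `3`. -/
def w13LonelyColoring : Fin 7 → Fin 7 → Fin 4 :=
  ![![3, 1, 2, 0, 0, 0, 1],
    ![0, 3, 2, 1, 1, 1, 0],
    ![0, 1, 3, 2, 2, 2, 0],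
    ![0, 1, 2, 3, 1, 2, 0],
    ![0, 1, 2, 0, 3, 2, 1],
    ![0, 1, 2, 0, 1, 3, 2],
    ![0, 1, 2, 0, 1, 2, 3]]

instance inst_s2 : DecidableRel w13.Adj := by
  unfold w13
  infer_instance

theorem w13LonelyColoring_valid :
    ∀ v a b, w13.Adj a b → w13LonelyColoring v a ≠ w13LonelyColoring v b := by
  decide

theorem w13LonelyColoring_injective_at :
    ∀ v u, w13LonelyColoring v u = w13LonelyColoring v v → u = v := by
  decide

/-- For every vertex `v` of the base graph `w₁₃` there is a proper 4-coloring of `w₁₃`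
in which `v` is the unique vertex receiving its color (a "lonely color"). -/
theorem w13_lonely_color (v : Fin 7) :
    ∃ C : w13.Coloring (Fin 4), ∀ u : Fin 7, C u = C v → u = v :=
  ⟨.mk (w13LonelyColoring v) (w13LonelyColoring_valid v _ _), w13LonelyColoring_injective_at v⟩
end
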